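/- Let m, n ≥ 1 and let ρ be a density matrix on ℂ^m ⊗ ℂ^n (a positive semidefinite mn × mn complex matrix, indexed by pairs in Fin m × Fin n, with trace 1). If ρ is absolutely PPT but not absolutely separable, then ρ is invertible (i.e., ρ has full rank mn). -/

import Mathlib

open Matrix BigOperators
open scoped ComplexOrder

noncomputable section

/-- The partial transpose (on the second factor) of a matrix indexed by `Fin m × Fin n`. -/
def partialTranspose {m n : ℕ} (X : Matrix (Fin m × Fin n) (Fin m × Fin n) ℂ) :
    Matrix (Fin m × Fin n) (Fin m × Fin n) ℂ :=
  Matrix.of fun p q => X (p.1, q.2) (q.1, p.2)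

/-- A state is absolutely PPT if every unitary conjugate has positive semidefinite
partial transpose. -/
def AbsolutelyPPT {m n : ℕ} (ρ : Matrix (Fin m × Fin n) (Fin m × Fin n) ℂ) : Prop :=
  ∀ U : Matrix (Fin m × Fin n) (Fin m × Fin n) ℂ,
    U ∈ Matrix.unitaryGroup (Fin m × Fin n) ℂ →
      (partialTranspose (U * ρ * Uᴴ)).PosSemidef

/-- A matrix is separable if it is a finite sum of Kronecker products of
positive semidefinite matrices. -/
def Separable {m n : ℕ} (σ : Matrix (Fin m × Fin n) (Fin m × Fin n) ℂ) : Prop :=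
  ∃ (k : ℕ) (A : Fin k → Matrix (Fin m) (Fin m) ℂ) (B : Fin k → Matrix (Fin n) (Fin n) ℂ),
    (∀ i, (A i).PosSemidef) ∧ (∀ i, (B i).PosSemidef) ∧
      σ = ∑ i, Matrix.kroneckerMap (· * ·) (A i) (B i)

/-- A state is absolutely separable if every unitary conjugate of it is separable. -/
def AbsolutelySeparable {m n : ℕ} (ρ : Matrix (Fin m × Fin n) (Fin m × Fin n) ℂ) : Prop :=
  ∀ U : Matrix (Fin m × Fin n) (Fin m × Fin n) ℂ,
    U ∈ Matrix.unitaryGroup (Fin m × Fin n) ℂ →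
      Separable (U * ρ * Uᴴ)

theorem separable_zero {m n : ℕ} :
    Separable (0 : Matrix (Fin m × Fin n) (Fin m × Fin n) ℂ) :=
  ⟨0, fun _ => 0, fun _ => 0, by simp, by simp, by simp⟩

theorem Separable.add {m n : ℕ} {X Y : Matrix (Fin m × Fin n) (Fin m × Fin n) ℂ}
    (hX : Separable X) (hY : Separable Y) : Separable (X + Y) := by
  obtain ⟨k, A, B, hA, hB, rfl⟩ := hX
  obtain ⟨l, A', B', hA', hB', rfl⟩ := hY
  refine ⟨k + l, Fin.append A A', Fin.append B B', ?_, ?_, ?_⟩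
  · intro i
    refine Fin.addCases (fun i => ?_) (fun i => ?_) i <;> simp [hA, hA']
  · intro i
    refine Fin.addCases (fun i => ?_) (fun i => ?_) i <;> simp [hB, hB']
  · simp [Fin.sum_univ_add]

theorem separable_sum {m n : ℕ} {ι : Type*} (s : Finset ι)
    {X : ι → Matrix (Fin m × Fin n) (Fin m × Fin n) ℂ} (hX : ∀ i ∈ s, Separable (X i)) :
    Separable (∑ i ∈ s, X i) :=
  Finset.sum_induction X Separable (fun _ _ => Separable.add) separable_zero hX

theorem separable_kronecker {m n : ℕ} {A : Matrix (Fin m) (Fin m) ℂ}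
    {B : Matrix (Fin n) (Fin n) ℂ} (hA : A.PosSemidef) (hB : B.PosSemidef) :
    Separable (Matrix.kroneckerMap (· * ·) A B) :=
  ⟨1, fun _ => A, fun _ => B, fun _ => hA, fun _ => hB, by simp⟩

theorem Separable.smul {m n : ℕ} {X : Matrix (Fin m × Fin n) (Fin m × Fin n) ℂ}
    (hX : Separable X) {c : ℝ} (hc : 0 ≤ c) : Separable ((c : ℂ) • X) := by
  obtain ⟨k, A, B, hA, hB, rfl⟩ := hX
  refine ⟨k, fun i => (c : ℂ) • A i, B, fun i => (hA i).smul (by exact_mod_cast hc), hB, ?_⟩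
  ext p q
  simp [Matrix.sum_apply, Finset.mul_sum, mul_assoc]

/-- The Kronecker product of the rank one matrices `x yᴴ` and `z wᴴ`. -/
def rankOneKronecker {m n : ℕ} (x y : Fin m → ℂ) (z w : Fin n → ℂ) :
    Matrix (Fin m × Fin n) (Fin m × Fin n) ℂ :=
  Matrix.kroneckerMap (· * ·) (vecMulVec x (star y)) (vecMulVec z (star w))

theorem rankOneKronecker_apply {m n : ℕ} (x y : Fin m → ℂ) (z w : Fin n → ℂ)
    (p q : Fin m × Fin n) :
    rankOneKronecker x y z w p q = x p.1 * star (y q.1) * (z p.2 * star (w q.2)) := by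
  simp [rankOneKronecker, vecMulVec_apply]

theorem separable_rankOneKronecker {m n : ℕ} (x : Fin m → ℂ) (z : Fin n → ℂ) :
    Separable (rankOneKronecker x x z z) :=
  separable_kronecker (posSemidef_vecMulVec_self_star _) (posSemidef_vecMulVec_self_star _)

/-- Twirling the product vector `(t x - ω y) ⊗ (z + ω⁻¹ s w)` over the fourth roots of unity `ω`
yields a separable matrix whose only coherences lie between `x ⊗ z` and `y ⊗ w`. -/
theorem separable_twirl {m n : ℕ} (x y : Fin m → ℂ) (z w : Fin n → ℂ) (s t : ℝ) :
    Separable ((t ^ 2 : ℂ) • rankOneKronecker x x z z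
      + (s ^ 2 * t ^ 2 : ℂ) • rankOneKronecker x x w w
      + rankOneKronecker y y z z + (s ^ 2 : ℂ) • rankOneKronecker y y w w
      - (s * t : ℂ) • (rankOneKronecker x y z w + rankOneKronecker y x w z)) := by
  have key : ∀ ω : ℂ, Separable (rankOneKronecker ((t : ℂ) • x - ω • y) ((t : ℂ) • x - ω • y)
      (z + (star ω * s) • w) (z + (star ω * s) • w)) :=
    fun ω => separable_rankOneKronecker _ _
  convert ((((key 1).add (key Complex.I)).add (key (-1))).add (key (-Complex.I))).smul
    (c := 1 / 4) (by norm_num) using 1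
  ext p q
  simp only [Matrix.add_apply, Matrix.sub_apply, Matrix.smul_apply, rankOneKronecker_apply,
    Pi.sub_apply, Pi.add_apply, Pi.smul_apply, smul_eq_mul, star_sub, star_add, star_mul',
    star_neg, star_one, Complex.star_def, Complex.conj_I, Complex.conj_ofReal, Complex.ofReal_div,
    Complex.ofReal_one, Complex.ofReal_ofNat]
  ring_nf
  simp only [Complex.I_sq, Complex.I_pow_four]
  ring

theorem separable_one_sub_of_schmidt {m n : ℕ} (e : Fin m → Fin m → ℂ) (f : Fin m → Fin n → ℂ)
    (s : Fin m → ℝ) (hs : ∑ i, s i ^ 2 = 1) (he : ∑ i, vecMulVec (e i) (star (e i)) = 1)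
    (hf : (1 - ∑ j, vecMulVec (f j) (star (f j))).PosSemidef) (ψ : Fin m × Fin n → ℂ)
    (hψ : ∀ a b, ψ (a, b) = ∑ i, s i * e i a * f i b) :
    Separable (1 - vecMulVec ψ (star ψ)) := by
  have hs1 : ∀ i, s i ^ 2 ≤ 1 := fun i => hs ▸
    Finset.single_le_sum (f := fun i => s i ^ 2) (fun i _ => sq_nonneg _) (Finset.mem_univ i)
  let T : Fin m → Fin m → Matrix (Fin m × Fin n) (Fin m × Fin n) ℂ := fun i j =>
    (((1 - s i ^ 2 * s j ^ 2) / 2 : ℝ) : ℂ) • rankOneKronecker (e i) (e i) (f j) (f j)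
      + ((1 / 2 : ℝ) : ℂ) • ((s j ^ 2 : ℂ) • rankOneKronecker (e i) (e i) (f i) (f i)
      + (s i ^ 2 * s j ^ 2 : ℂ) • rankOneKronecker (e i) (e i) (f j) (f j)
      + rankOneKronecker (e j) (e j) (f i) (f i)
      + (s i ^ 2 : ℂ) • rankOneKronecker (e j) (e j) (f j) (f j)
      - (s i * s j : ℂ) • (rankOneKronecker (e i) (e j) (f i) (f j)
        + rankOneKronecker (e j) (e i) (f j) (f i)))
  have hT : ∀ i j, Separable (T i j) := fun i j =>
    ((separable_rankOneKronecker _ _).smul (by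
      nlinarith [hs1 i, hs1 j, mul_le_one₀ (hs1 i) (sq_nonneg (s j)) (hs1 j)])).add
    ((separable_twirl _ _ _ _ _ _).smul (by norm_num))
  have hTd : ∀ i, T i i = rankOneKronecker (e i) (e i) (f i) (f i) := by
    intro i
    ext p q
    simp only [T, Matrix.add_apply, Matrix.sub_apply, Matrix.smul_apply, smul_eq_mul]
    push_cast
    ring
  have hsc : ∑ i, (s i : ℂ) ^ 2 = 1 := by exact_mod_cast hs
  have main : 1 - vecMulVec ψ (star ψ) =
      ∑ i, Matrix.kroneckerMap (· * ·) (vecMulVec (e i) (star (e i)))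
        (1 - ∑ j, vecMulVec (f j) (star (f j)))
      + ∑ i, ∑ j, if i = j then 0 else T i j := by
    have hoff : (∑ i, ∑ j, if i = j then 0 else T i j)
        = ∑ i, ∑ j, T i j - ∑ i, rankOneKronecker (e i) (e i) (f i) (f i) := by
      rw [← Finset.sum_sub_distrib]
      refine Finset.sum_congr rfl fun i _ => ?_
      rw [← hTd, eq_sub_iff_add_eq]
      rw [← Finset.sum_erase_add _ _ (Finset.mem_univ i),
        ← Finset.sum_erase_add _ (fun j => T i j) (Finset.mem_univ i)]
      simp only [if_true, add_zero]
      congr 1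
      refine Finset.sum_congr rfl fun j hj => ?_
      rw [if_neg (Finset.ne_of_mem_erase hj).symm]
    have hTsum : ∑ i, ∑ j, T i j = ∑ i, ∑ j, rankOneKronecker (e i) (e i) (f j) (f j)
        + ∑ i, rankOneKronecker (e i) (e i) (f i) (f i)
        - ∑ i, ∑ j, (s i * s j : ℂ) • rankOneKronecker (e i) (e j) (f i) (f j) := by
      have swap : ∀ F : Fin m → Fin m → Matrix (Fin m × Fin n) (Fin m × Fin n) ℂ,
          ∑ i, ∑ j, F i j = ((1 / 2 : ℝ) : ℂ) • (∑ i, ∑ j, (F i j + F j i)) := by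
        intro F
        simp only [Finset.sum_add_distrib]
        rw [Finset.sum_comm (f := fun i j => F j i), ← two_smul ℂ, smul_smul]
        norm_num
      have hd : ∑ i, rankOneKronecker (e i) (e i) (f i) (f i)
          = ∑ i, ∑ j, (s j ^ 2 : ℂ) • rankOneKronecker (e i) (e i) (f i) (f i) := by
        simp [← Finset.sum_smul, hsc]
      rw [hd, ← Finset.sum_add_distrib, ← Finset.sum_sub_distrib]
      simp only [← Finset.sum_add_distrib, ← Finset.sum_sub_distrib]
      rw [swap, swap (fun i j => _ - _)]
      congr 1
      refine Finset.sum_congr rfl fun i _ => Finset.sum_congr rfl fun j _ => ?_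
      ext p q
      simp only [T, Matrix.add_apply, Matrix.sub_apply, Matrix.smul_apply, smul_eq_mul]
      push_cast
      ring
    rw [hoff, hTsum]
    have h1 : ∑ i, Matrix.kroneckerMap (· * ·) (vecMulVec (e i) (star (e i)))
        (1 - ∑ j, vecMulVec (f j) (star (f j)))
        = 1 - ∑ i, ∑ j, rankOneKronecker (e i) (e i) (f j) (f j) := by
      have h2 : (1 : Matrix (Fin m × Fin n) (Fin m × Fin n) ℂ)
          = Matrix.kroneckerMap (· * ·) (∑ i, vecMulVec (e i) (star (e i))) 1 := by
        rw [he, Matrix.kroneckerMap_one_one] <;> simp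
      rw [h2]
      ext p q
      simp [Matrix.sum_apply, Finset.sum_mul, mul_sub, Finset.mul_sum, rankOneKronecker,
        Finset.sum_sub_distrib]
    have h3 : vecMulVec ψ (star ψ)
        = ∑ i, ∑ j, (s i * s j : ℂ) • rankOneKronecker (e i) (e j) (f i) (f j) := by
      ext p q
      simp only [vecMulVec_apply, Pi.star_apply, Matrix.sum_apply, Matrix.smul_apply,
        rankOneKronecker_apply, smul_eq_mul]
      rw [hψ p.1 p.2, hψ q.1 q.2, star_sum, Finset.sum_mul_sum]
      refine Finset.sum_congr rfl fun i _ => Finset.sum_congr rfl fun j _ => ?_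
      simp only [star_mul', Complex.star_def, Complex.conj_ofReal]
      ring
    rw [h1, h3]
    abel
  rw [main]
  refine (separable_sum _ fun i _ => separable_kronecker (posSemidef_vecMulVec_self_star _) hf).add
    (separable_sum _ fun i _ => separable_sum _ fun j _ => ?_)
  split_ifs
  exacts [separable_zero, hT i j]

theorem posSemidef_one_sub_conjTranspose_mul_self {ι κ : Type*} [Fintype ι] [Fintype κ]
    [DecidableEq κ] {G : Matrix ι κ ℂ} (hG : G * Gᴴ * G = G) : (1 - Gᴴ * G).PosSemidef := by
  have h : (1 - Gᴴ * G)ᴴ * (1 - Gᴴ * G) = 1 - Gᴴ * G := by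
    have h2 : Gᴴ * G * (Gᴴ * G) = Gᴴ * G := by
      rw [Matrix.mul_assoc, ← Matrix.mul_assoc G, hG]
    rw [conjTranspose_sub, conjTranspose_one, conjTranspose_mul, conjTranspose_conjTranspose,
      Matrix.sub_mul, Matrix.mul_sub, Matrix.mul_sub, h2]
    simp
  exact h ▸ posSemidef_conjTranspose_mul_self _

theorem separable_one_sub_vecMulVec {m n : ℕ} (ψ : Fin m × Fin n → ℂ) (hψ : ψ ⬝ᵥ star ψ = 1) :
    Separable (1 - vecMulVec ψ (star ψ)) := by
  let C : Matrix (Fin m) (Fin n) ℂ := Matrix.of fun a b => ψ (a, b)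
  have hC : (C * Cᴴ).PosSemidef := posSemidef_self_mul_conjTranspose C
  let W : Matrix (Fin m) (Fin m) ℂ := hC.isHermitian.eigenvectorUnitary
  have hW : Wᴴ * W = 1 := Unitary.coe_star_mul_self hC.isHermitian.eigenvectorUnitary
  have hW' : W * Wᴴ = 1 := Unitary.coe_mul_star_self hC.isHermitian.eigenvectorUnitary
  let d := hC.isHermitian.eigenvalues
  have hd : ∀ i, 0 ≤ d i := hC.eigenvalues_nonneg
  have hspec : C * Cᴴ = W * diagonal (fun i => (d i : ℂ)) * Wᴴ := by
    have := hC.isHermitian.spectral_theorem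
    rwa [Unitary.conjStarAlgAut_apply] at this
  let V : Matrix (Fin m) (Fin n) ℂ := Wᴴ * C
  have hV : V * Vᴴ = diagonal (fun i => (d i : ℂ)) := by
    calc V * Vᴴ = Wᴴ * (C * Cᴴ) * W := by
          simp only [V, conjTranspose_mul, conjTranspose_conjTranspose, Matrix.mul_assoc]
      _ = (Wᴴ * W) * diagonal (fun i => (d i : ℂ)) * (Wᴴ * W) := by
          rw [hspec]; simp only [Matrix.mul_assoc]
      _ = _ := by rw [hW, Matrix.one_mul, Matrix.mul_one]
  have hVrow : ∀ i, d i = 0 → V i = 0 := by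
    intro i hi
    have := congr_fun (congr_fun hV i) i
    rw [diagonal_apply_eq, hi, Complex.ofReal_zero, Matrix.mul_apply] at this
    exact dotProduct_self_star_eq_zero.1 this
  let r : Fin m → ℝ := fun i => √(d i)
  have hr : ∀ i, r i ^ 2 = d i := fun i => Real.sq_sqrt (hd i)
  let G : Matrix (Fin m) (Fin n) ℂ := diagonal (fun i => ((r i)⁻¹ : ℂ)) * V
  have hG : ∀ i b, (r i : ℂ) * G i b = V i b := by
    intro i b
    simp only [G, Matrix.diagonal_mul]
    by_cases h : r i = 0
    · rw [hVrow i (by rw [← hr, h]; norm_num), h]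
      simp
    · field_simp
  have hGG : G * Gᴴ * G = G := by
    have h1 : G * Gᴴ = diagonal (fun i => ((r i)⁻¹ * d i * (r i)⁻¹ : ℂ)) := by
      calc G * Gᴴ = diagonal (fun i => ((r i)⁻¹ : ℂ)) * (V * Vᴴ)
            * diagonal (fun i => ((r i)⁻¹ : ℂ)) := by
            simp only [G, conjTranspose_mul, Matrix.mul_assoc, diagonal_conjTranspose]
            congr 4
            ext i
            simp
        _ = _ := by simp [hV, diagonal_mul_diagonal]
    rw [h1]
    ext i b
    simp only [G, Matrix.diagonal_mul]
    rw [← hr]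
    by_cases h : (r i : ℂ) = 0
    · simp [h]
    · push_cast
      field_simp
  have hF : ∑ j, vecMulVec (G j) (star (G j)) = (Gᴴ * G)ᵀ := by
    ext a b
    simp [Matrix.sum_apply, vecMulVec_apply, Matrix.mul_apply, mul_comm]
  refine separable_one_sub_of_schmidt (fun i a => W a i) G r ?_ ?_ ?_ ψ ?_
  · have h1 : (C * Cᴴ).trace = 1 := by
      rw [← hψ]
      simp [Matrix.trace, Matrix.mul_apply, dotProduct, Fintype.sum_prod_type, C]
    rw [hspec, Matrix.mul_assoc, trace_mul_comm, Matrix.mul_assoc, hW, Matrix.mul_one,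
      trace_diagonal] at h1
    simp only [hr]
    exact_mod_cast h1
  · rw [← hW']
    ext a b
    simp [Matrix.sum_apply, vecMulVec_apply, Matrix.mul_apply]
  · rw [hF]
    simpa using (posSemidef_one_sub_conjTranspose_mul_self hGG).transpose
  · intro a b
    have h1 : C = W * V := by rw [← Matrix.mul_assoc, hW', Matrix.one_mul]
    have h2 : ψ (a, b) = (W * V) a b := by rw [← h1]; rfl
    rw [h2, Matrix.mul_apply]
    refine Finset.sum_congr rfl fun i _ => ?_
    rw [← hG]
    ring

theorem separable_of_fin_one_left {n : ℕ} {X : Matrix (Fin 1 × Fin n) (Fin 1 × Fin n) ℂ}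
    (hX : X.PosSemidef) : Separable X := by
  convert separable_kronecker (PosSemidef.one (n := Fin 1))
    (hX.submatrix fun b : Fin n => ((0 : Fin 1), b)) using 1
  ext ⟨a, b⟩ ⟨c, d⟩
  fin_cases a; fin_cases c
  simp

theorem separable_of_fin_one_right {m : ℕ} {X : Matrix (Fin m × Fin 1) (Fin m × Fin 1) ℂ}
    (hX : X.PosSemidef) : Separable X := by
  convert separable_kronecker (hX.submatrix fun a : Fin m => (a, (0 : Fin 1)))
    (PosSemidef.one (n := Fin 1)) using 1
  ext ⟨a, b⟩ ⟨c, d⟩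
  fin_cases b; fin_cases d
  simp

theorem posSemidef_apply_eq_zero {ι : Type*} [Fintype ι] [DecidableEq ι] {X : Matrix ι ι ℂ}
    (hX : X.PosSemidef) {i j : ι} (hi : X i i = 0) : X j i = 0 := by
  have h : X *ᵥ Pi.single i 1 = 0 :=
    (hX.dotProduct_mulVec_zero_iff _).1 (by simp [hi])
  simpa using congr_fun h j

theorem exists_perm_map_triple {α : Type*} [DecidableEq α] {a b c x y z : α}
    (hab : a ≠ b) (hac : a ≠ c) (hbc : b ≠ c) (hxy : x ≠ y) (hxz : x ≠ z) (hyz : y ≠ z) :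
    ∃ σ : Equiv.Perm α, σ a = x ∧ σ b = y ∧ σ c = z := by
  have := Equiv.Perm.isMultiplyPretransitive α 3
  have h1 : Function.Injective ![a, b, c] := by
    intro i j; fin_cases i <;> fin_cases j <;> simp_all [Ne.symm]
  have h2 : Function.Injective ![x, y, z] := by
    intro i j; fin_cases i <;> fin_cases j <;> simp_all [Ne.symm]
  obtain ⟨σ, hσ⟩ := MulAction.exists_smul_eq (Equiv.Perm α) (⟨_, h1⟩ : Fin 3 ↪ α) ⟨_, h2⟩
  have hval := fun i => DFunLike.congr_fun hσ i
  exact ⟨σ, hval 0, hval 1, hval 2⟩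

/-- If a unitary conjugate of an absolutely PPT matrix is diagonal and one diagonal entry vanishes,
then all other diagonal entries agree. -/
theorem AbsolutelyPPT.diag_eq {m n : ℕ} (hm : 2 ≤ m) (hn : 2 ≤ n)
    {ρ W : Matrix (Fin m × Fin n) (Fin m × Fin n) ℂ} (hppt : AbsolutelyPPT ρ)
    (hW : W ∈ Matrix.unitaryGroup (Fin m × Fin n) ℂ) {d : Fin m × Fin n → ℂ}
    (hρ : ρ = W * diagonal d * Wᴴ) {k x y : Fin m × Fin n} (hk : d k = 0)
    (hx : x ≠ k) (hy : y ≠ k) : d x = d y := by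
  by_contra hxy
  let a₀ : Fin m := ⟨0, by omega⟩
  let a₁ : Fin m := ⟨1, by omega⟩
  let b₀ : Fin n := ⟨0, by omega⟩
  let b₁ : Fin n := ⟨1, by omega⟩
  have ha : a₀ ≠ a₁ := by simp [a₀, a₁]
  have hb : b₀ ≠ b₁ := by simp [b₀, b₁]
  obtain ⟨σ, h0, h1, h2⟩ := exists_perm_map_triple (a := (a₀, b₀)) (b := (a₁, b₁)) (c := (a₀, b₁))
    (x := x) (y := y) (z := k) (by simp [ha]) (by simp [hb]) (by simp [ha.symm])
    (fun h => hxy (by rw [h])) hx hy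
  let v : Fin m × Fin n → ℂ := Pi.single (a₀, b₀) (3 / 5) + Pi.single (a₁, b₁) (4 / 5)
  have hv : star v = v := by
    simp [v]
  have hvv : v ⬝ᵥ v = 1 := by
    simp [v, dotProduct_add, ha, ha.symm]
    norm_num
  let R : Matrix (Fin m × Fin n) (Fin m × Fin n) ℂ := 1 - (2 : ℂ) • vecMulVec v v
  have hRH : Rᴴ = R := by
    simp [R, conjTranspose_vecMulVec, hv]
  have hRR : R * R = 1 := by
    simp only [R, Matrix.sub_mul, Matrix.mul_sub, Matrix.one_mul, Matrix.mul_one, smul_mul_smul,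
      vecMulVec_mul_vecMulVec, hvv, one_smul]
    module
  let W' := W.submatrix id σ
  have hWW : Wᴴ * W = 1 := (Matrix.mem_unitaryGroup_iff').1 hW
  have hW' : W'ᴴ * W' = 1 := by
    rw [conjTranspose_submatrix, ← Matrix.submatrix_mul _ _ _ _ _ Function.bijective_id, hWW,
      Matrix.submatrix_one_equiv]
  have hρ' : ρ = W' * diagonal (d ∘ σ) * W'ᴴ := by
    rw [conjTranspose_submatrix, ← submatrix_diagonal_equiv, submatrix_mul_equiv,
      submatrix_mul_equiv, submatrix_id_id, hρ]
  have hU : R * W'ᴴ ∈ Matrix.unitaryGroup (Fin m × Fin n) ℂ := by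
    rw [Matrix.mem_unitaryGroup_iff, star_eq_conjTranspose, conjTranspose_mul,
      conjTranspose_conjTranspose, hRH, Matrix.mul_assoc, ← Matrix.mul_assoc W'ᴴ, hW',
      Matrix.one_mul, hRR]
  have hconj : R * W'ᴴ * ρ * (R * W'ᴴ)ᴴ = R * diagonal (d ∘ σ) * R := by
    rw [hρ', conjTranspose_mul, conjTranspose_conjTranspose, hRH]
    calc _ = R * (W'ᴴ * W') * diagonal (d ∘ σ) * (W'ᴴ * W') * R := by
          simp only [Matrix.mul_assoc]
      _ = _ := by rw [hW', Matrix.mul_one, Matrix.mul_one]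
  have hpos := hppt _ hU
  rw [hconj] at hpos
  have hentry : ∀ p q, (R * diagonal (d ∘ σ) * R) p q =
      diagonal (d ∘ σ) p q - 2 * v p * v q * (d (σ p) + d (σ q))
        + 4 * v p * v q * (9 / 25 * d x + 16 / 25 * d y) := by
    intro p q
    have hdv : v ⬝ᵥ diagonal (d ∘ σ) *ᵥ v = 9 / 25 * d x + 16 / 25 * d y := by
      simp [v, mulVec_add, ha, ha.symm, h0, h1]
      ring
    have hexp : R * diagonal (d ∘ σ) * R = diagonal (d ∘ σ)
        - (2 : ℂ) • vecMulVec v (v ᵥ* diagonal (d ∘ σ))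
        - (2 : ℂ) • vecMulVec (diagonal (d ∘ σ) *ᵥ v) v
        + (4 * (v ⬝ᵥ diagonal (d ∘ σ) *ᵥ v)) • vecMulVec v v := by
      have hquad : vecMulVec v v * diagonal (d ∘ σ) * vecMulVec v v
          = (v ⬝ᵥ diagonal (d ∘ σ) *ᵥ v) • vecMulVec v v := by
        rw [Matrix.mul_assoc, mul_vecMulVec, vecMulVec_mul_vecMulVec, vecMulVec_smul]
      rw [← vecMulVec_mul, ← mul_vecMulVec, mul_smul, ← hquad]
      simp only [R, Matrix.sub_mul, Matrix.mul_sub, Matrix.one_mul, Matrix.mul_one,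
        smul_mul_assoc, mul_smul_comm]
      module
    rw [hexp, hdv]
    simp only [Matrix.add_apply, Matrix.sub_apply, Matrix.smul_apply, vecMulVec_apply,
      vecMul_diagonal, mulVec_diagonal, smul_eq_mul, Function.comp_apply]
    ring
  have hz := posSemidef_apply_eq_zero hpos (i := (a₀, b₁)) (j := (a₁, b₀)) (by
    simp only [partialTranspose, Matrix.of_apply, hentry]
    simp [v, ha, hb.symm, h2, hk])
  simp only [partialTranspose, Matrix.of_apply, hentry] at hz
  simp [v, ha, hb, ha.symm, hb.symm, h0, h1] at hz
  apply hxy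
  linear_combination (-625 / 168 : ℂ) * hz

/-- If a density matrix is absolutely PPT but not absolutely separable, then it has full rank. -/
theorem absPPT_not_absSep_invertible {m n : ℕ} (hm : 1 ≤ m) (hn : 1 ≤ n)
    (ρ : Matrix (Fin m × Fin n) (Fin m × Fin n) ℂ)
    (hρ : ρ.PosSemidef) (htr : ρ.trace = 1)
    (hppt : AbsolutelyPPT ρ) (hsep : ¬ AbsolutelySeparable ρ) :
    IsUnit ρ := by
  by_contra hunit
  refine hsep fun U hU => ?_
  have hpos : (U * ρ * Uᴴ).PosSemidef := hρ.mul_mul_conjTranspose_same U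
  obtain rfl | hm2 := hm.eq_or_lt
  · exact separable_of_fin_one_left hpos
  obtain rfl | hn2 := hn.eq_or_lt
  · exact separable_of_fin_one_right hpos
  let d := hρ.isHermitian.eigenvalues
  let W : Matrix (Fin m × Fin n) (Fin m × Fin n) ℂ := hρ.isHermitian.eigenvectorUnitary
  have hW : W ∈ Matrix.unitaryGroup (Fin m × Fin n) ℂ := hρ.isHermitian.eigenvectorUnitary.2
  have hspec : ρ = W * diagonal (fun i => (d i : ℂ)) * Wᴴ := by
    have := hρ.isHermitian.spectral_theorem
    rwa [Unitary.conjStarAlgAut_apply] at this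
  obtain ⟨k, hk⟩ : ∃ k, d k = 0 := by
    rw [Matrix.isUnit_iff_isUnit_det, isUnit_iff_ne_zero, not_not,
      hρ.isHermitian.det_eq_prod_eigenvalues, Finset.prod_eq_zero_iff] at hunit
    obtain ⟨k, -, hk⟩ := hunit
    exact ⟨k, Complex.ofReal_eq_zero.1 hk⟩
  have : Nontrivial (Fin m × Fin n) := by
    have := Fin.nontrivial_iff_two_le.2 hm2
    have : Nonempty (Fin n) := ⟨⟨0, by omega⟩⟩
    infer_instance
  obtain ⟨x, hx⟩ := exists_ne k
  have hUW : U * W ∈ Matrix.unitaryGroup (Fin m × Fin n) ℂ := mul_mem hU hW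
  have hUW1 : U * W * (U * W)ᴴ = 1 := (Matrix.mem_unitaryGroup_iff).1 hUW
  have hUW2 : (U * W)ᴴ * (U * W) = 1 := (Matrix.mem_unitaryGroup_iff').1 hUW
  have hdiag : diagonal (fun i => (d i : ℂ))
      = (d x : ℂ) • (1 - vecMulVec (Pi.single k 1) (Pi.single k 1)) := by
    ext p q
    rcases eq_or_ne p q with rfl | hpq
    · rcases eq_or_ne p k with rfl | hp
      · simp [vecMulVec_apply, hk]
      · simp [vecMulVec_apply, hp, hppt.diag_eq hm2 hn2 hW hspec (by simp [hk]) hp hx]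
    · rcases eq_or_ne p k with rfl | hp
      · simp [vecMulVec_apply, hpq, hpq.symm]
      · simp [vecMulVec_apply, hpq, hp]
  let ψ : Fin m × Fin n → ℂ := fun p => (U * W) p k
  have hψ : ψ ⬝ᵥ star ψ = 1 := by
    have := congr_fun (congr_fun hUW2 k) k
    rw [Matrix.mul_apply, Matrix.one_apply_eq] at this
    rw [dotProduct_comm]
    exact this
  have hfinal : U * ρ * Uᴴ = (d x : ℂ) • (1 - vecMulVec ψ (star ψ)) := by
    calc U * ρ * Uᴴ = (U * W) * diagonal (fun i => (d i : ℂ)) * (U * W)ᴴ := by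
          rw [hspec, conjTranspose_mul]; simp only [Matrix.mul_assoc]
      _ = _ := by
          rw [hdiag, Matrix.mul_smul, Matrix.smul_mul, Matrix.mul_sub, Matrix.sub_mul,
            Matrix.mul_one, hUW1, mul_vecMulVec, vecMulVec_mul]
          congr 3
          · ext p; simp [ψ]
          · ext p; simp only [single_one_vecMul]; rfl
  rw [hfinal]
  exact (separable_one_sub_vecMulVec ψ hψ).smul (hρ.eigenvalues_nonneg x)

end
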